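/- Let Ω ⊂ ℝⁿ be a bounded open set, u : Ω → ℝ bounded and lower semicontinuous, q ≥ 2 and ε > 0. If u_ε is Fréchet differentiable at a point x ∈ Ω_{r(ε)} and Du_ε(x) = 0, then u_ε(x) = u(x). -/

import Mathlib

open MeasureTheory Metric Set Filter Asymptotics
open scoped RealInnerProductSpace NNReal Topology

noncomputable section

abbrev En (n : ℕ) := EuclideanSpace ℝ (Fin n)

/-- The nondivergence-form `p(·)`-Laplacian `-Δ_{p(·)} φ` at `x`. -/
noncomputable def negPLap {n : ℕ} (p φ : En n → ℝ) (x : En n) : ℝ :=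
  -(‖gradient φ x‖ ^ (p x - 2) *
      LinearMap.trace ℝ (En n) (fderiv ℝ (gradient φ) x : En n →ₗ[ℝ] En n))
  - (p x - 2) * ‖gradient φ x‖ ^ (p x - 4) *
      ⟪fderiv ℝ (gradient φ) x (gradient φ x), gradient φ x⟫
  - ‖gradient φ x‖ ^ (p x - 2) * Real.log ‖gradient φ x‖ *
      ⟪gradient p x, gradient φ x⟫

/-- `u` is a viscosity supersolution of `-Δ_{p(·)} u = 0` on an open set `D`. -/
def IsViscositySupersolution {n : ℕ} (p u : En n → ℝ) (D : Set (En n)) : Prop :=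
  ∀ x₀ ∈ D, ∀ φ : En n → ℝ,
    ContDiffAt ℝ 2 φ x₀ → φ x₀ = u x₀ →
    (∀ᶠ x in 𝓝[≠] x₀, φ x < u x) →
    gradient φ x₀ ≠ 0 → 0 ≤ negPLap p φ x₀

/-- The infimal convolution `u_ε` of `u`. -/
noncomputable def infConv {n : ℕ} (u : En n → ℝ) (Ω : Set (En n)) (q ε : ℝ) (x : En n) : ℝ :=
  sInf ((fun y => u y + ‖x - y‖ ^ q / (q * ε ^ (q - 1))) '' Ω)

/-- `r(ε) = (q ε^{q-1} (M - m))^{1/q}` where `M = sup u`, `m = inf u`. -/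
noncomputable def rEps {n : ℕ} (u : En n → ℝ) (Ω : Set (En n)) (q ε : ℝ) : ℝ :=
  (q * ε ^ (q - 1) * (sSup (u '' Ω) - sInf (u '' Ω))) ^ (1 / q)

/-- `Ω_r = {x ∈ Ω : dist(x, ∂Ω) > r}`. -/
def innerSet {n : ℕ} (Ω : Set (En n)) (r : ℝ) : Set (En n) :=
  {x ∈ Ω | r < Metric.infDist x (frontier Ω)}

/-- The set of minimizers `Y_ε(x)`. -/
def Yset {n : ℕ} (u : En n → ℝ) (Ω : Set (En n)) (q ε : ℝ) (x : En n) : Set (En n) :=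
  {y ∈ Ω | infConv u Ω q ε x = u y + ‖x - y‖ ^ q / (q * ε ^ (q - 1))}

/-- `f` is locally Lipschitz on `s`. -/
def LocLipschitzOn {n : ℕ} (f : En n → ℝ) (s : Set (En n)) : Prop :=
  ∀ x ∈ s, ∃ K : ℝ≥0, ∃ t ∈ 𝓝[s] x, LipschitzOnWith K f t

open Classical in
/-- `|Du(x)|^{p(x)-2} ⟨Du(x), Dψ(x)⟩`, taken to be `0` where `Du(x) = 0`. -/
noncomputable def weakIntegrand {n : ℕ} (p u ψ : En n → ℝ) (x : En n) : ℝ :=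
  if gradient u x = 0 then 0
  else ‖gradient u x‖ ^ (p x - 2) * ⟪gradient u x, gradient ψ x⟫


theorem infConv_le {n : ℕ} {u : En n → ℝ} {Ω : Set (En n)} {q ε : ℝ}
    (hbddB : BddBelow (u '' Ω)) (hq : 0 < q) (hε : 0 < ε) (z : En n) {y : En n} (hy : y ∈ Ω) :
    infConv u Ω q ε z ≤ u y + ‖z - y‖ ^ q / (q * ε ^ (q - 1)) := by
  obtain ⟨m, hm⟩ := hbddB
  refine csInf_le ⟨m, ?_⟩ (mem_image_of_mem _ hy)
  rintro _ ⟨w, hw, rfl⟩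
  have h₁ : m ≤ u w := hm (mem_image_of_mem u hw)
  have h₂ : 0 ≤ ‖z - w‖ ^ q / (q * ε ^ (q - 1)) := by positivity
  dsimp only
  linarith

/-- Moving from `x` towards an almost minimizer `y` decreases `u_ε` at a definite rate. -/
theorem infConv_add_smul_le {n : ℕ} {u : En n → ℝ} {Ω : Set (En n)} {q ε : ℝ}
    (hbddB : BddBelow (u '' Ω)) (hq : 1 ≤ q) (hε : 0 < ε) (x : En n) {y : En n} (hy : y ∈ Ω)
    {t : ℝ} (ht₀ : 0 ≤ t) (ht₁ : t < 1) :
    infConv u Ω q ε (x + t • (y - x)) ≤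
      u y + (1 - t) * (‖x - y‖ ^ q / (q * ε ^ (q - 1))) := by
  have hq₀ : 0 < q := by linarith
  have ht : 0 < 1 - t := by linarith
  have hnorm : ‖x + t • (y - x) - y‖ = (1 - t) * ‖x - y‖ := by
    rw [show x + t • (y - x) - y = (1 - t) • (x - y) by module, norm_smul,
      Real.norm_of_nonneg ht.le]
  have hpow : (1 - t) ^ q ≤ 1 - t := by
    simpa using Real.rpow_le_rpow_of_exponent_ge ht (by linarith) hq
  refine (infConv_le hbddB hq₀ hε _ hy).trans ?_
  rw [hnorm, Real.mul_rpow ht.le (norm_nonneg _), mul_div_assoc]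
  gcongr

/-- if `Du_ε(x) = 0` then `u_ε(x) = u(x)`. -/
theorem stmt12
    {n : ℕ} (hn : 1 ≤ n)
    (Ω : Set (En n)) (hΩo : IsOpen Ω) (hΩb : Bornology.IsBounded Ω)
    (u : En n → ℝ)
    (hbddA : BddAbove (u '' Ω)) (hbddB : BddBelow (u '' Ω))
    (hlsc : LowerSemicontinuousOn u Ω)
    (q ε : ℝ) (hq : 2 ≤ q) (hε : 0 < ε)
    (x : En n) (hx : x ∈ innerSet Ω (rEps u Ω q ε))
    (hg : HasGradientAt (infConv u Ω q ε) 0 x) :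
    infConv u Ω q ε x = u x := by
  have hxΩ : x ∈ Ω := hx.1
  have hq₀ : 0 < q := by linarith
  apply le_antisymm
  · simpa [Real.zero_rpow hq₀.ne'] using infConv_le hbddB hq₀ hε x hxΩ
  by_contra! hlt
  obtain ⟨a, hIa, hau⟩ := exists_between hlt
  obtain ⟨ρ₀, hρ₀, hnear⟩ := Metric.mem_nhdsWithin_iff.1 (hlsc x hxΩ a hau)
  obtain ⟨R, hR, hRb⟩ := hΩb.subset_closedBall_lt 0 x
  set κ : ℝ := ρ₀ ^ q / (q * ε ^ (q - 1)) with hκ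
  have hκ₀ : 0 < κ := by positivity
  have hη : 0 < κ / (3 * R) := by positivity
  have hlo := (hasFDerivAt_iff_isLittleO.1 hg.hasFDerivAt).def hη
  obtain ⟨ρ, hρ, hdiff⟩ := Metric.eventually_nhds_iff.1 hlo
  set t : ℝ := ρ / (ρ + R) with ht
  have ht₀ : 0 < t := by positivity
  have ht₁ : t < 1 := by rw [ht, div_lt_one (by positivity)]; linarith
  have htR : t * R < ρ := by
    rw [ht, div_mul_eq_mul_div, div_lt_iff₀ (by positivity)]
    nlinarith
  have hδ : 0 < min (a - infConv u Ω q ε x) (t * κ / 3) :=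
    lt_min (by linarith) (by positivity)
  obtain ⟨_, ⟨y, hy, rfl⟩, hyI⟩ := exists_lt_of_csInf_lt (Set.Nonempty.image _ ⟨x, hxΩ⟩)
    (lt_add_of_pos_right (infConv u Ω q ε x) hδ)
  dsimp only at hyI
  have hδ₁ := min_le_left (a - infConv u Ω q ε x) (t * κ / 3)
  have hδ₂ := min_le_right (a - infConv u Ω q ε x) (t * κ / 3)
  have hpen : 0 ≤ ‖x - y‖ ^ q / (q * ε ^ (q - 1)) := by positivity
  have hfar : ρ₀ ≤ ‖x - y‖ := by
    by_contra! hclose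
    have hay : a < u y := hnear ⟨by rwa [Metric.mem_ball, dist_comm, dist_eq_norm], hy⟩
    linarith
  have hκy : κ ≤ ‖x - y‖ ^ q / (q * ε ^ (q - 1)) := by
    rw [hκ]
    gcongr
  have hyR : ‖y - x‖ ≤ R := by simpa [dist_eq_norm] using hRb hy
  have hstep : ‖t • (y - x)‖ ≤ t * R := by
    rw [norm_smul, Real.norm_of_nonneg ht₀.le]
    gcongr
  have hgrad := hdiff (y := x + t • (y - x)) (by
    rw [dist_eq_norm, add_sub_cancel_left]
    exact hstep.trans_lt htR)
  simp only [map_zero, zero_apply, sub_zero, add_sub_cancel_left,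
    Real.norm_eq_abs] at hgrad
  have hslope : κ / (3 * R) * ‖t • (y - x)‖ ≤ t * κ / 3 := by
    calc κ / (3 * R) * ‖t • (y - x)‖ ≤ κ / (3 * R) * (t * R) := by gcongr
      _ = t * κ / 3 := by field_simp
  have hdec := infConv_add_smul_le hbddB (by linarith : 1 ≤ q) hε x hy ht₀.le ht₁
  have hlow := (abs_le.1 hgrad).1
  have htκ := mul_le_mul_of_nonneg_left hκy ht₀.le
  have htκ₀ : 0 < t * κ := by positivity
  linarith
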